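/- Let m be a positive integer, λ > 0 a real number, and let f : D → B^m be a C²-smooth map with d_{B^m}(f(z), f(w)) = √λ · ρ(z, w) for all z, w ∈ D. Suppose f extends C¹-smoothly to D ∪ U for some nonempty open arc U ⊂ ∂D, and the radial derivative of f is nonzero at every point of U. Then λ = 1 and there exists a biholomorphic automorphism Ψ of B^m such that either Ψ(f(ζ)) = (ζ, 0, …, 0) for all ζ ∈ D, or Ψ(f(ζ)) = (conj(ζ), 0, …, 0) for all ζ ∈ D. -/

import Mathlib

open Complex Metric Set Filter

noncomputable section

/-- The open unit disc in `ℂ`. -/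
def unitDisc : Set ℂ := {z : ℂ | ‖z‖ < 1}

/-- The unit circle, the boundary of the unit disc. -/
def unitCircle : Set ℂ := {z : ℂ | ‖z‖ = 1}

/-- Inverse hyperbolic tangent. -/
def artanh (x : ℝ) : ℝ := Real.log ((1 + x) / (1 - x)) / 2

/-- The Poincaré distance on the unit disc. -/
def pdist (z w : ℂ) : ℝ := artanh ‖(z - w) / (1 - (starRingEnd ℂ) w * z)‖

/-- The Bergman (hyperbolic) distance on the unit ball `B^m ⊂ ℂ^m`. -/
def ballDist {m : ℕ} (z w : EuclideanSpace ℂ (Fin m)) : ℝ :=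
  artanh (Real.sqrt
    (1 - (1 - ‖z‖ ^ 2) * (1 - ‖w‖ ^ 2) /
      ‖1 - ∑ j, z j * (starRingEnd ℂ) (w j)‖ ^ 2))

/-- `Ψ` is a biholomorphic automorphism of the unit ball `B^m`. -/
def IsBiholoAutBall (m : ℕ) (Ψ : EuclideanSpace ℂ (Fin m) → EuclideanSpace ℂ (Fin m)) : Prop :=
  Set.MapsTo Ψ (Metric.ball 0 1) (Metric.ball 0 1) ∧
  DifferentiableOn ℂ Ψ (Metric.ball 0 1) ∧
  ∃ Φ : EuclideanSpace ℂ (Fin m) → EuclideanSpace ℂ (Fin m),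
    Set.MapsTo Φ (Metric.ball 0 1) (Metric.ball 0 1) ∧
    DifferentiableOn ℂ Φ (Metric.ball 0 1) ∧
    (∀ z ∈ Metric.ball (0 : EuclideanSpace ℂ (Fin m)) 1, Φ (Ψ z) = z) ∧
    (∀ z ∈ Metric.ball (0 : EuclideanSpace ℂ (Fin m)) 1, Ψ (Φ z) = z)

/-- The embedding `ℂ → ℂ^m`, `ζ ↦ (ζ, 0, …, 0)`. -/
def inclDisc (m : ℕ) (ζ : ℂ) : EuclideanSpace ℂ (Fin m) :=
  WithLp.toLp 2 fun j => if (j : ℕ) = 0 then ζ else 0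

/-- The involutive automorphism of the ball exchanging `a` and `0`. -/
def phi {m : ℕ} (a z : EuclideanSpace ℂ (Fin m)) : EuclideanSpace ℂ (Fin m) :=
  (1 - inner ℂ a z)⁻¹ • ((1 - inner ℂ a z / (1 + (Real.sqrt (1 - ‖a‖ ^ 2) : ℂ))) • a
    - (Real.sqrt (1 - ‖a‖ ^ 2) : ℂ) • z)

lemma phi_def {m : ℕ} (a z : EuclideanSpace ℂ (Fin m)) : phi a z =
    (1 - inner ℂ a z)⁻¹ • ((1 - inner ℂ a z / (1 + (Real.sqrt (1 - ‖a‖ ^ 2) : ℂ))) • a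
    - (Real.sqrt (1 - ‖a‖ ^ 2) : ℂ) • z) := rfl

lemma sum_eq_inner {m : ℕ} (z w : EuclideanSpace ℂ (Fin m)) :
    ∑ j, z j * (starRingEnd ℂ) (w j) = inner ℂ w z := by
  simp [PiLp.inner_apply]

lemma one_sub_inner_ne {m : ℕ} {a z : EuclideanSpace ℂ (Fin m)} (ha : ‖a‖ < 1) (hz : ‖z‖ ≤ 1) :
    1 - inner ℂ a z ≠ (0 : ℂ) := by
  intro h
  have h1 : inner ℂ a z = (1 : ℂ) := by linear_combination -h
  have h2 := norm_inner_le_norm (𝕜 := ℂ) a z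
  rw [h1, norm_one] at h2
  nlinarith [norm_nonneg a, norm_nonneg z]

lemma sig_facts {m : ℕ} {a : EuclideanSpace ℂ (Fin m)} (ha : ‖a‖ < 1) :
    ∃ σ : ℝ, Real.sqrt (1 - ‖a‖ ^ 2) = σ ∧ 0 < σ ∧ (inner ℂ a a : ℂ) = 1 - (σ : ℂ) ^ 2
      ∧ (σ : ℂ) ≠ 0 ∧ 1 + (σ : ℂ) ≠ 0 := by
  have h0 : 0 < 1 - ‖a‖ ^ 2 := by nlinarith [norm_nonneg a]
  have hp := Real.sqrt_pos.2 h0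
  refine ⟨_, rfl, hp, ?_, ?_, ?_⟩
  · rw [inner_self_eq_norm_sq_to_K]
    have := Real.sq_sqrt h0.le
    rw [← Complex.ofReal_pow, this]
    push_cast
    simp
  · exact_mod_cast hp.ne'
  · have : (1 + Real.sqrt (1 - ‖a‖ ^ 2)) ≠ 0 := by positivity
    exact_mod_cast this

lemma inner_phi {m : ℕ} {a z w : EuclideanSpace ℂ (Fin m)} (ha : ‖a‖ < 1) (hz : ‖z‖ ≤ 1)
    (hw : ‖w‖ ≤ 1) :
    (1 - inner ℂ (phi a w) (phi a z)) * ((1 - inner ℂ a z) * (1 - inner ℂ w a))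
      = ((1 - ‖a‖ ^ 2 : ℝ) : ℂ) * (1 - inner ℂ w z) := by
  obtain ⟨σ, hσ, hpos, haa, h1, h2⟩ := sig_facts ha
  have hz' := one_sub_inner_ne ha hz
  have hw' : 1 - inner ℂ w a ≠ (0 : ℂ) := by
    have := one_sub_inner_ne ha hw
    intro h
    apply this
    have := congrArg (starRingEnd ℂ) h
    simpa using this
  have hA : ((1 - ‖a‖ ^ 2 : ℝ) : ℂ) = (σ : ℂ) ^ 2 := by
    rw [← hσ, ← Complex.ofReal_pow, Real.sq_sqrt]
    nlinarith [norm_nonneg a]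
  rw [hA]
  unfold phi
  rw [hσ]
  simp only [inner_smul_left, inner_smul_right, inner_sub_left, inner_sub_right, map_inv₀, map_sub,
    map_one, map_div₀, map_add, Complex.conj_ofReal, inner_conj_symm, haa]
  field_simp
  ring

lemma inner_phi_self {m : ℕ} {a z : EuclideanSpace ℂ (Fin m)} (ha : ‖a‖ < 1) (hz : ‖z‖ ≤ 1) :
    inner ℂ a (phi a z) = (inner ℂ a a - inner ℂ a z) / (1 - inner ℂ a z) := by
  obtain ⟨σ, hσ, hpos, haa, h1, h2⟩ := sig_facts ha
  have hz' := one_sub_inner_ne ha hz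
  unfold phi
  rw [hσ]
  simp only [inner_smul_right, inner_sub_right, haa]
  field_simp
  ring

lemma phi_phi {m : ℕ} {a z : EuclideanSpace ℂ (Fin m)} (ha : ‖a‖ < 1) (hz : ‖z‖ ≤ 1) :
    phi a (phi a z) = z := by
  obtain ⟨σ, hσ, hpos, haa, h1, h2⟩ := sig_facts ha
  have hz' := one_sub_inner_ne ha hz
  have h := inner_phi_self ha hz
  rw [haa] at h
  have h3 : 1 - inner ℂ a (phi a z) = (σ : ℂ) ^ 2 / (1 - inner ℂ a z) := by
    rw [h]; field_simp; ring
  rw [phi_def a (phi a z), h3, h, hσ, phi_def a z, hσ]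
  generalize (inner ℂ a z : ℂ) = x at *
  have : ∀ c d : ℂ, c = 0 → d = 1 → c • a + d • z = z := by
    rintro c d rfl rfl; simp
  refine Eq.trans ?_ (this (((σ : ℂ) ^ 2 / (1 - x))⁻¹ *
    ((1 - (1 - (σ : ℂ) ^ 2 - x) / (1 - x) / (1 + σ))
    - σ * ((1 - x)⁻¹ * (1 - x / (1 + σ)))))
    (((σ : ℂ) ^ 2 / (1 - x))⁻¹ * (σ * ((1 - x)⁻¹ * σ))) ?_ ?_)
  · module
  · field_simp; ring
  · field_simp

lemma phi_self {m : ℕ} {a : EuclideanSpace ℂ (Fin m)} (ha : ‖a‖ < 1) : phi a a = 0 := by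
  obtain ⟨σ, hσ, hpos, haa, h1, h2⟩ := sig_facts ha
  unfold phi
  rw [hσ, haa]
  have : (1 - (1 - (σ : ℂ) ^ 2) / (1 + σ)) = σ := by field_simp; ring
  rw [this]; simp

lemma norm_phi {m : ℕ} {a z : EuclideanSpace ℂ (Fin m)} (ha : ‖a‖ < 1) (hz : ‖z‖ ≤ 1) :
    (1 - ‖phi a z‖ ^ 2) * ‖1 - inner ℂ a z‖ ^ 2 = (1 - ‖a‖ ^ 2) * (1 - ‖z‖ ^ 2) := by
  have h := inner_phi ha hz hz
  have h2 : (1 - inner ℂ z a : ℂ) = (starRingEnd ℂ) (1 - inner ℂ a z) := by simp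
  rw [h2, Complex.mul_conj, Complex.normSq_eq_norm_sq, inner_self_eq_norm_sq_to_K,
    inner_self_eq_norm_sq_to_K] at h
  simp only [Complex.coe_algebraMap] at h
  exact_mod_cast h

lemma phi_maps {m : ℕ} {a z : EuclideanSpace ℂ (Fin m)} (ha : ‖a‖ < 1) (hz : ‖z‖ < 1) :
    ‖phi a z‖ < 1 := by
  have h := norm_phi ha hz.le
  have h1 : 0 < 1 - ‖a‖ ^ 2 := by nlinarith [norm_nonneg a]
  have h2 : 0 < 1 - ‖z‖ ^ 2 := by nlinarith [norm_nonneg z]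
  have h3 := mul_pos h1 h2
  rw [← h] at h3
  have := pos_of_mul_pos_left h3 (by positivity)
  nlinarith [norm_nonneg (phi a z)]

/-- the quantity `1 / cosh² d`. -/
def Qf {m : ℕ} (z w : EuclideanSpace ℂ (Fin m)) : ℝ :=
  (1 - ‖z‖ ^ 2) * (1 - ‖w‖ ^ 2) / ‖1 - (inner ℂ w z : ℂ)‖ ^ 2

lemma Qf_phi {m : ℕ} {a z w : EuclideanSpace ℂ (Fin m)} (ha : ‖a‖ < 1) (hz : ‖z‖ < 1)
    (hw : ‖w‖ < 1) : Qf (phi a z) (phi a w) = Qf z w := by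
  have h1 := norm_phi ha hz.le
  have h2 := norm_phi ha hw.le
  have h3 := congrArg (fun x : ℂ => ‖x‖ ^ 2) (inner_phi ha hz.le hw.le)
  have h4 : (1 - inner ℂ w a : ℂ) = (starRingEnd ℂ) (1 - inner ℂ a w) := by simp
  rw [h4] at h3
  simp only [norm_mul, mul_pow, RCLike.norm_conj, Complex.norm_real, Real.norm_eq_abs, sq_abs] at h3
  have p1 : 0 < ‖1 - (inner ℂ a z : ℂ)‖ := norm_pos_iff.2 (one_sub_inner_ne ha hz.le)
  have p2 : 0 < ‖1 - (inner ℂ a w : ℂ)‖ := norm_pos_iff.2 (one_sub_inner_ne ha hw.le)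
  have p3 : 0 < ‖1 - (inner ℂ w z : ℂ)‖ := norm_pos_iff.2 (one_sub_inner_ne hw hz.le)
  have p4 : 0 < ‖1 - (inner ℂ (phi a w) (phi a z) : ℂ)‖ :=
    norm_pos_iff.2 (one_sub_inner_ne (phi_maps ha hw) (phi_maps ha hz).le)
  have h0 : 0 < 1 - ‖a‖ ^ 2 := by nlinarith [norm_nonneg a]
  unfold Qf
  rw [div_eq_div_iff (by positivity) (by positivity)]
  generalize ‖1 - (inner ℂ a z : ℂ)‖ = A at *
  generalize ‖1 - (inner ℂ a w : ℂ)‖ = B at *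
  generalize ‖1 - (inner ℂ w z : ℂ)‖ = C at *
  generalize ‖1 - (inner ℂ (phi a w) (phi a z) : ℂ)‖ = D at *
  generalize 1 - ‖phi a z‖ ^ 2 = X at *
  generalize 1 - ‖phi a w‖ ^ 2 = Y at *
  generalize 1 - ‖z‖ ^ 2 = Z at *
  generalize 1 - ‖w‖ ^ 2 = W at *
  generalize 1 - ‖a‖ ^ 2 = T at *
  have : (A ^ 2 * B ^ 2 * T ^ 2) ≠ 0 := by positivity
  apply mul_left_cancel₀ this
  calc _ = (X * A ^ 2) * (Y * B ^ 2) * (T ^ 2 * C ^ 2) := by ring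
    _ = _ := by rw [h1, h2, ← h3]; ring

lemma Qf_pos {m : ℕ} {z w : EuclideanSpace ℂ (Fin m)} (hz : ‖z‖ < 1)
    (hw : ‖w‖ < 1) : 0 < Qf z w := by
  have p3 : 0 < ‖1 - (inner ℂ w z : ℂ)‖ := norm_pos_iff.2 (one_sub_inner_ne hw hz.le)
  have h1 : 0 < 1 - ‖z‖ ^ 2 := by nlinarith [norm_nonneg z]
  have h2 : 0 < 1 - ‖w‖ ^ 2 := by nlinarith [norm_nonneg w]
  unfold Qf
  positivity

lemma Qf_le {m : ℕ} {z w : EuclideanSpace ℂ (Fin m)} (hz : ‖z‖ < 1)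
    (hw : ‖w‖ < 1) : Qf z w ≤ 1 := by
  have p3 : 0 < ‖1 - (inner ℂ w z : ℂ)‖ := norm_pos_iff.2 (one_sub_inner_ne hw hz.le)
  have h2 := norm_inner_le_norm (𝕜 := ℂ) w z
  have h3 := norm_sub_norm_le (1 : ℂ) (inner ℂ w z)
  rw [norm_one] at h3
  unfold Qf
  rw [div_le_one (by positivity)]
  have h4 : ‖w‖ * ‖z‖ ≤ 1 := by nlinarith [norm_nonneg z, norm_nonneg w]
  have : (1 - ‖w‖ * ‖z‖) ^ 2 ≤ ‖1 - (inner ℂ w z : ℂ)‖ ^ 2 :=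
    pow_le_pow_left₀ (by linarith) (by linarith) 2
  nlinarith [sq_nonneg (‖w‖ - ‖z‖)]

lemma phi_diff {m : ℕ} {a z : EuclideanSpace ℂ (Fin m)} (ha : ‖a‖ < 1) (hz : ‖z‖ ≤ 1) :
    DifferentiableAt ℂ (phi a) z := by
  have h : DifferentiableAt ℂ (fun z : EuclideanSpace ℂ (Fin m) => (inner ℂ a z : ℂ)) z :=
    (innerSL ℂ a).differentiableAt
  unfold phi
  apply DifferentiableAt.fun_smul
  · exact ((differentiableAt_const _).sub h).inv (one_sub_inner_ne ha hz)
  · apply DifferentiableAt.fun_sub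
    · apply DifferentiableAt.smul_const
      exact (differentiableAt_const _).sub (by simp only [div_eq_mul_inv]; exact h.mul_const _)
    · fun_prop

/-- `tanh (s * artanh x)`. -/
def Gf (s x : ℝ) : ℝ := (1 - ((1 - x) / (1 + x)) ^ s) / (1 + ((1 - x) / (1 + x)) ^ s)

lemma Gf_one {s : ℝ} (hs : s ≠ 0) : Gf s 1 = 1 := by
  simp [Gf, Real.zero_rpow hs]

lemma Gf_deriv {s : ℝ} (hs : 1 < s) : HasDerivAt (Gf s) 0 1 := by
  have h1 : HasDerivAt (fun x : ℝ => (1 - x) / (1 + x)) (-1 / 2) 1 := by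
    have := ((hasDerivAt_id (1 : ℝ)).const_sub 1).div ((hasDerivAt_id (1 : ℝ)).const_add 1)
      (by norm_num)
    refine HasDerivAt.congr_deriv (f := fun x : ℝ => (1 - x) / (1 + x)) this ?_
    norm_num
  have h2 : HasDerivAt (fun x : ℝ => ((1 - x) / (1 + x)) ^ s) 0 1 := by
    have := h1.rpow_const (p := s) (Or.inr hs.le)
    convert this using 1
    have : s - 1 ≠ 0 := by linarith
    simp [Real.zero_rpow this]
  have h3 := (h2.const_sub 1).div (h2.const_add 1) (by
    have : s ≠ 0 := by linarith
    simp [Real.zero_rpow this])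
  refine HasDerivAt.congr_deriv (f := Gf s) h3 ?_
  simp

lemma Gf_aux {T : ℝ} (hT : 0 ≤ T) : (1 - (1 - T) / (1 + T)) / (1 + (1 - T) / (1 + T)) = T := by
  have : 1 + T ≠ 0 := by positivity
  field_simp
  ring

lemma Gf_inv {s x : ℝ} (hs : s ≠ 0) (h0 : 0 ≤ x) (h1 : x ≤ 1) : Gf s⁻¹ (Gf s x) = x := by
  have ht : 0 ≤ (1 - x) / (1 + x) := div_nonneg (by linarith) (by linarith)
  unfold Gf
  rw [Gf_aux (Real.rpow_nonneg ht s), ← Real.rpow_mul ht, mul_inv_cancel₀ hs, Real.rpow_one]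
  have : 1 + x ≠ 0 := by positivity
  field_simp
  ring

lemma Gf_cont {s : ℝ} (hs : 0 < s) : ContinuousAt (Gf s) 1 := by
  have h1 : ContinuousAt (fun x : ℝ => ((1 - x) / (1 + x)) ^ s) 1 := by
    apply ContinuousAt.rpow_const
    · apply ContinuousAt.div (by fun_prop) (by fun_prop) (by norm_num)
    · right; exact hs.le
  apply ContinuousAt.div (by fun_prop) (by fun_prop)
  simp [Real.zero_rpow hs.ne']

/-- the pseudo-hyperbolic distance. -/
def tauf (z w : ℂ) : ℝ := ‖(z - w) / (1 - (starRingEnd ℂ) w * z)‖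

lemma disc_den_ne {z w : ℂ} (hz : ‖z‖ < 1) (hw : ‖w‖ < 1) : 1 - (starRingEnd ℂ) w * z ≠ 0 := by
  intro h
  have h1 : (starRingEnd ℂ) w * z = 1 := by linear_combination -h
  have h2 := congrArg norm h1
  rw [norm_mul, RCLike.norm_conj, norm_one] at h2
  nlinarith [norm_nonneg w, norm_nonneg z]

lemma tauf_sq {z w : ℂ} (hz : ‖z‖ < 1) (hw : ‖w‖ < 1) :
    1 - tauf z w ^ 2 = (1 - ‖z‖ ^ 2) * (1 - ‖w‖ ^ 2) / ‖1 - (starRingEnd ℂ) w * z‖ ^ 2 := by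
  have h := norm_pos_iff.2 (disc_den_ne hz hw)
  unfold tauf
  rw [norm_div, eq_div_iff (by positivity), div_pow, sub_mul, div_mul_cancel₀ _ (by positivity)]
  simp only [Complex.sq_norm, Complex.normSq_apply]
  simp
  ring

lemma tauf_nonneg (z w : ℂ) : 0 ≤ tauf z w := norm_nonneg _

lemma tauf_lt {z w : ℂ} (hz : ‖z‖ < 1) (hw : ‖w‖ < 1) : tauf z w < 1 := by
  have h := norm_pos_iff.2 (disc_den_ne hz hw)
  have h1 := tauf_sq hz hw
  have h2 : 0 < 1 - ‖z‖ ^ 2 := by nlinarith [norm_nonneg z]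
  have h3 : 0 < 1 - ‖w‖ ^ 2 := by nlinarith [norm_nonneg w]
  have h4 : 0 < 1 - tauf z w ^ 2 := by rw [h1]; positivity
  nlinarith [tauf_nonneg z w]

lemma tpos {x : ℝ} (h0 : 0 ≤ x) (h1 : x < 1) : 0 < (1 - x) / (1 + x) :=
  div_pos (by linarith) (by linarith)

lemma artanh_eq {s N τ : ℝ} (hN0 : 0 ≤ N) (hN1 : N < 1) (h0 : 0 ≤ τ) (h1 : τ < 1)
    (h : artanh N = s * artanh τ) : N = Gf s τ := by
  have e : ∀ x : ℝ, artanh x = - Real.log ((1 - x) / (1 + x)) / 2 := by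
    intro x
    unfold artanh
    rw [← Real.log_inv, inv_div]
  rw [e, e] at h
  have h2 : Real.log ((1 - N) / (1 + N)) = Real.log (((1 - τ) / (1 + τ)) ^ s) := by
    rw [Real.log_rpow (tpos h0 h1)]
    linarith
  have h3 := Real.log_injOn_pos (tpos hN0 hN1) (Real.rpow_pos_of_pos (tpos h0 h1) s) h2
  unfold Gf
  rw [← h3]
  have : 1 + N ≠ 0 := by positivity
  field_simp
  ring

lemma Gf_nonneg {s x : ℝ} (hs : 0 < s) (h0 : 0 ≤ x) (h1 : x < 1) : 0 ≤ Gf s x := by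
  have h := tpos h0 h1
  have h2 : ((1 - x) / (1 + x)) ^ s ≤ 1 := by
    apply Real.rpow_le_one h.le _ hs.le
    rw [div_le_one (by linarith)]
    linarith
  have h3 := Real.rpow_pos_of_pos h s
  unfold Gf
  exact div_nonneg (by linarith) (by linarith)

lemma Gf_pos {s x : ℝ} (hs : 0 < s) (h0 : 0 < x) (h1 : x < 1) : 0 < Gf s x := by
  have h := tpos h0.le h1
  have h2 : ((1 - x) / (1 + x)) ^ s < 1 := by
    apply Real.rpow_lt_one h.le _ hs
    rw [div_lt_one (by linarith)]
    linarith
  have h3 := Real.rpow_pos_of_pos h s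
  unfold Gf
  exact div_pos (by linarith) (by linarith)

lemma Q_of_iso {m : ℕ} {s : ℝ} {x y : EuclideanSpace ℂ (Fin m)} (hx : ‖x‖ < 1) (hy : ‖y‖ < 1)
    {z w : ℂ} (hz : ‖z‖ < 1) (hw : ‖w‖ < 1) (h : ballDist x y = s * pdist z w) :
    Qf x y = 1 - Gf s (tauf z w) ^ 2 := by
  have h1 := Qf_pos hx hy
  have h2 := Qf_le hx hy
  have h3 : ballDist x y = artanh (Real.sqrt (1 - Qf x y)) := by
    unfold ballDist Qf
    rw [sum_eq_inner]
  rw [h3] at h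
  have h4 : Real.sqrt (1 - Qf x y) < 1 := by
    rw [Real.sqrt_lt' one_pos]; linarith
  rw [← artanh_eq (Real.sqrt_nonneg _) h4 (tauf_nonneg z w) (tauf_lt hz hw) h, Real.sq_sqrt]
  · ring
  · linarith

lemma norm_h {m : ℕ} {s : ℝ} (hs : 0 < s) {x : EuclideanSpace ℂ (Fin m)} {z : ℂ} (hz : ‖z‖ < 1)
    (h : Qf x 0 = 1 - Gf s (tauf z 0) ^ 2) : ‖x‖ = Gf s ‖z‖ := by
  have h1 : tauf z 0 = ‖z‖ := by simp [tauf]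
  have h2 : Qf x 0 = 1 - ‖x‖ ^ 2 := by simp [Qf]
  rw [h1, h2] at h
  have h3 := Gf_nonneg hs (norm_nonneg z) hz
  exact (pow_left_inj₀ (norm_nonneg x) h3 two_ne_zero).1 (by linarith)

lemma tauf_ray {q : ℂ} (hq : ‖q‖ = 1) {r t : ℝ} (h1 : r < 1) (ht0 : 0 < t)
    (htr : t ≤ r) : tauf (r * q) (t * q) = (r - t) / (1 - r * t) := by
  have hqq : (starRingEnd ℂ) q * q = 1 := by
    rw [mul_comm, Complex.mul_conj, Complex.normSq_eq_norm_sq, hq]; simp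
  unfold tauf
  have e1 : (r : ℂ) * q - t * q = ((r - t : ℝ) : ℂ) * q := by push_cast; ring
  have e2 : 1 - (starRingEnd ℂ) ((t : ℂ) * q) * (r * q) = ((1 - r * t : ℝ) : ℂ) := by
    push_cast
    rw [map_mul, Complex.conj_ofReal]
    linear_combination (-(r : ℂ) * t) * hqq
  have h3 : 0 < 1 - r * t := by nlinarith
  rw [e1, e2, norm_div, norm_mul, hq, Complex.norm_real, Complex.norm_real, Real.norm_of_nonneg,
    Real.norm_of_nonneg h3.le, mul_one]
  linarith

lemma ray_aux {m : ℕ} {s : ℝ} (hs : 0 < s) {x y : EuclideanSpace ℂ (Fin m)} (hx : ‖x‖ < 1)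
    (hy : ‖y‖ < 1) {q : ℂ} (hq : ‖q‖ = 1) {r t : ℝ} (h1 : r < 1)
    (ht0 : 0 < t) (htr : t ≤ r) (hxn : ‖x‖ = Gf s r) (hyn : ‖y‖ = Gf s t)
    (h : Qf x y = 1 - Gf s (tauf (r * q) (t * q)) ^ 2) :
    (‖y‖ : ℂ) • x = (‖x‖ : ℂ) • y := by
  have h0 : 0 < r := by linarith
  have ht1 : t < 1 := by linarith
  have hT : 0 < ((1 - r) / (1 + r)) ^ s := Real.rpow_pos_of_pos (tpos h0.le h1) s
  have hS : 0 < ((1 - t) / (1 + t)) ^ s := Real.rpow_pos_of_pos (tpos ht0.le ht1) s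
  have h3 : 0 < 1 - r * t := by nlinarith
  have hd : ((1 - (r - t) / (1 - r * t)) / (1 + (r - t) / (1 - r * t))) ^ s
      = ((1 - r) / (1 + r)) ^ s / ((1 - t) / (1 + t)) ^ s := by
    rw [← Real.div_rpow (tpos h0.le h1).le (tpos ht0.le ht1).le]
    congr 1
    have a1 : 1 + r ≠ 0 := by positivity
    have a2 : 1 + t ≠ 0 := by positivity
    have a3 : 1 - t ≠ 0 := by linarith
    have a4 : 1 - r * t + (r - t) ≠ 0 := by nlinarith
    rw [div_div_div_eq]
    field_simp
    ring
  rw [tauf_ray hq h1 ht0 htr] at h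
  have hxy : ‖1 - (inner ℂ y x : ℂ)‖ = 1 - ‖x‖ * ‖y‖ := by
    have p : 0 < ‖1 - (inner ℂ y x : ℂ)‖ := norm_pos_iff.2 (one_sub_inner_ne hy hx.le)
    have p' : 0 < 1 - ‖x‖ * ‖y‖ := by nlinarith [norm_nonneg x, norm_nonneg y]
    refine (pow_left_inj₀ p.le p'.le two_ne_zero).1 ?_
    unfold Qf at h
    rw [div_eq_iff (by positivity), hxn, hyn] at h
    rw [hxn, hyn]
    simp only [Gf] at h ⊢
    rw [hd] at h
    generalize ((1 - r) / (1 + r)) ^ s = T at *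
    generalize ((1 - t) / (1 + t)) ^ s = S at *
    have e1 : 1 - ((1 - T / S) / (1 + T / S)) ^ 2 = 4 * T * S / (S + T) ^ 2 := by
      field_simp; ring
    have e2 : (1 - ((1 - T) / (1 + T)) ^ 2) * (1 - ((1 - S) / (1 + S)) ^ 2)
        = 16 * T * S / ((1 + T) ^ 2 * (1 + S) ^ 2) := by
      field_simp; ring
    have e3 : 1 - (1 - T) / (1 + T) * ((1 - S) / (1 + S)) = 2 * (S + T) / ((1 + T) * (1 + S)) := by
      field_simp; ring
    rw [e1, e2] at h
    rw [e3]
    generalize ‖1 - (inner ℂ y x : ℂ)‖ ^ 2 = N at *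
    field_simp at h ⊢
    linear_combination (-1 / 4) * h
  have hle := norm_inner_le_norm (𝕜 := ℂ) y x
  have hxy2 : (inner ℂ y x : ℂ) = (‖y‖ : ℂ) * ‖x‖ := by
    have a1 := congrArg (· ^ 2) hxy
    have a2 := pow_le_pow_left₀ (norm_nonneg _) hle 2
    have a3 := (Complex.re_le_norm (inner ℂ y x : ℂ)).trans hle
    simp only [Complex.sq_norm, Complex.normSq_apply] at a1 a2
    simp only [Complex.sub_re, Complex.one_re, Complex.sub_im, Complex.one_im] at a1
    have p' : 0 < 1 - ‖x‖ * ‖y‖ := by nlinarith [norm_nonneg x, norm_nonneg y]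
    have b1 : (inner ℂ y x : ℂ).re = ‖y‖ * ‖x‖ := by nlinarith
    have b2 : (inner ℂ y x : ℂ).im = 0 := by
      rw [b1] at a2
      nlinarith
    apply Complex.ext
    · rw [b1]; simp
    · rw [b2]; simp
  exact ((inner_eq_norm_mul_iff (𝕜 := ℂ)).1 hxy2).symm

lemma ray_exists {m : ℕ} {s : ℝ} (hs : 0 < s) {h : ℂ → EuclideanSpace ℂ (Fin m)}
    (hlt : ∀ z, ‖z‖ < 1 → ‖h z‖ < 1)
    (hn : ∀ z, ‖z‖ < 1 → ‖h z‖ = Gf s ‖z‖)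
    (hQ : ∀ z w, ‖z‖ < 1 → ‖w‖ < 1 → Qf (h z) (h w) = 1 - Gf s (tauf z w) ^ 2)
    {q : ℂ} (hq : ‖q‖ = 1) :
    ∃ e : EuclideanSpace ℂ (Fin m), ‖e‖ = 1 ∧
      ∀ r : ℝ, 0 < r → r < 1 → h (r * q) = (Gf s r : ℂ) • e := by
  have hnr : ∀ r : ℝ, 0 < r → r < 1 → ‖(r : ℂ) * q‖ = r := by
    intro r h0 h1
    rw [norm_mul, hq, Complex.norm_real, Real.norm_of_nonneg h0.le, mul_one]
  have key : ∀ r t : ℝ, 0 < t → t ≤ r → r < 1 →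
      (Gf s t : ℂ) • h (r * q) = (Gf s r : ℂ) • h (t * q) := by
    intro r t ht htr hr
    have a := hnr r (by linarith) hr
    have b := hnr t ht (by linarith)
    have a1 : ‖(r : ℂ) * q‖ < 1 := by rw [a]; exact hr
    have b1 : ‖(t : ℂ) * q‖ < 1 := by rw [b]; linarith
    have := ray_aux hs (hlt _ a1) (hlt _ b1) hq hr ht htr (by rw [hn _ a1, a])
      (by rw [hn _ b1, b]) (hQ _ _ a1 b1)
    rwa [hn _ a1, hn _ b1, a, b] at this
  have key2 : ∀ r t : ℝ, 0 < t → t < 1 → 0 < r → r < 1 →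
      (Gf s t : ℂ) • h (r * q) = (Gf s r : ℂ) • h (t * q) := by
    intro r t ht ht1 hr hr1
    rcases le_total t r with h | h
    · exact key r t ht h hr1
    · exact (key t r hr h ht1).symm
  have hp : 0 < Gf s (1 / 2) := Gf_pos hs (by norm_num) (by norm_num)
  have hp' : (Gf s (1 / 2) : ℂ) ≠ 0 := by exact_mod_cast hp.ne'
  refine ⟨(Gf s (1 / 2) : ℂ)⁻¹ • h ((1 / 2 : ℝ) * q), ?_, ?_⟩
  · have b := hnr (1 / 2) (by norm_num) (by norm_num)
    rw [norm_smul, hn _ (by rw [b]; norm_num), b, norm_inv, Complex.norm_real,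
      Real.norm_of_nonneg hp.le, inv_mul_cancel₀ hp.ne']
  · intro r h0 h1
    rw [smul_comm, ← key2 r (1 / 2) (by norm_num) (by norm_num) h0 h1, inv_smul_smul₀ hp']

lemma radial {m : ℕ} {s : ℝ} (hs : 0 < s) {a : EuclideanSpace ℂ (Fin m)} (ha : ‖a‖ < 1)
    {f : ℂ → EuclideanSpace ℂ (Fin m)} {S : Set ℂ} (hS : unitDisc ⊆ S) {q : ℂ} (hq : ‖q‖ = 1)
    {f' : ℂ →L[ℝ] EuclideanSpace ℂ (Fin m)} (hf : HasFDerivWithinAt f f' S q) (hne : f' q ≠ 0)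
    (hlt : ∀ z ∈ unitDisc, ‖f z‖ < 1) {e : EuclideanSpace ℂ (Fin m)} (he : ‖e‖ = 1)
    (hray : ∀ r : ℝ, 0 < r → r < 1 → phi a (f (r * q)) = (Gf s r : ℂ) • e) : s = 1 := by
  have hmem : ∀ r ∈ Ioo (0 : ℝ) 1, (r : ℂ) * q ∈ unitDisc := by
    intro r hr
    change ‖(r : ℂ) * q‖ < 1
    rw [norm_mul, hq, Complex.norm_real, Real.norm_of_nonneg hr.1.le, mul_one]
    exact hr.2
  have hud : UniqueDiffWithinAt ℝ (Ioo (0 : ℝ) 1) 1 := by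
    apply uniqueDiffWithinAt_convex (convex_Ioo 0 1)
    · rw [interior_Ioo]; exact ⟨1 / 2, by norm_num, by norm_num⟩
    · rw [closure_Ioo (by norm_num)]; exact ⟨by norm_num, le_rfl⟩
  have hNB : (nhdsWithin (1 : ℝ) (Ioo 0 1)).NeBot := by
    rw [← mem_closure_iff_nhdsWithin_neBot, closure_Ioo (by norm_num)]
    exact ⟨by norm_num, le_rfl⟩
  have hline : HasDerivWithinAt (fun r : ℝ => (r : ℂ) * q) q (Ioo 0 1) 1 := by
    have := ((Complex.ofRealCLM.hasDerivAt (x := (1 : ℝ))).mul_const q).hasDerivWithinAt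
      (s := Ioo (0 : ℝ) 1)
    simpa using this
  have hc : HasDerivWithinAt (fun r : ℝ => f (r * q)) (f' q) (Ioo 0 1) 1 := by
    have h1 : HasFDerivWithinAt f f' S ((fun r : ℝ => (r : ℂ) * q) 1) := by simpa using hf
    exact h1.comp_hasDerivWithinAt (1 : ℝ) hline (fun r hr => hS (hmem r hr))
  have hct : Tendsto (fun r : ℝ => f (r * q)) (nhdsWithin 1 (Ioo 0 1)) (nhds (f q)) := by
    have := hc.continuousWithinAt
    unfold ContinuousWithinAt at this
    simpa using this
  have hfq : ‖f q‖ ≤ 1 := by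
    refine le_of_tendsto hct.norm ?_
    filter_upwards [self_mem_nhdsWithin] with r hr
    exact (hlt _ (hmem r hr)).le
  have hGt : Tendsto (Gf s) (nhdsWithin 1 (Ioo 0 1)) (nhds 1) := by
    have := (Gf_cont hs).tendsto
    rw [Gf_one hs.ne'] at this
    exact this.mono_left nhdsWithin_le_nhds
  have hpf : phi a (f q) = e := by
    have h1 := ((phi_diff ha hfq).continuousAt.tendsto).comp hct
    have h2 : Tendsto (fun r : ℝ => (Gf s r : ℂ) • e) (nhdsWithin 1 (Ioo 0 1)) (nhds e) := by
      have := ((Complex.continuous_ofReal.tendsto 1).comp hGt).smul_const e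
      simpa using this
    refine tendsto_nhds_unique (h1.congr' ?_) h2
    filter_upwards [self_mem_nhdsWithin] with r hr
    exact hray r hr.1 hr.2
  have hback : f q = phi a e := by rw [← hpf, phi_phi ha hfq]
  rcases lt_trichotomy s 1 with h | h | h
  · exfalso
    have hd : HasFDerivAt (𝕜 := ℝ) (phi a) ((fderiv ℂ (phi a) (f q)).restrictScalars ℝ) (f q) :=
      (phi_diff ha hfq).hasFDerivAt.restrictScalars ℝ
    have h1 : HasFDerivAt (𝕜 := ℝ) (phi a) ((fderiv ℂ (phi a) (f q)).restrictScalars ℝ)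
      ((fun r : ℝ => f (r * q)) 1) := by simpa using hd
    have h2 := h1.comp_hasDerivWithinAt (1 : ℝ) hc
    have h3 := ((Complex.reCLM).hasFDerivAt.comp_hasDerivWithinAt (1 : ℝ)
      (((innerSL ℂ e).restrictScalars ℝ).hasFDerivAt.comp_hasDerivWithinAt (1 : ℝ) h2))
    obtain ⟨d, h3⟩ : ∃ d, HasDerivWithinAt (Gf s) d (Ioo 0 1) 1 := by
      refine ⟨_, h3.congr ?_ ?_⟩
      · intro r hr
        simp only [Function.comp_apply]
        rw [hray r hr.1 hr.2]
        simp [he]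
      · simp [hpf, he, Gf_one hs.ne']
    have h4 : HasDerivAt (Gf s⁻¹) 0 (Gf s 1) := by
      rw [Gf_one hs.ne']
      exact Gf_deriv ((one_lt_inv₀ hs).2 h)
    have h5 := h4.comp_hasDerivWithinAt (1 : ℝ) h3
    have h6 : HasDerivWithinAt (fun x : ℝ => x) (0 * d) (Ioo 0 1) 1 := by
      refine h5.congr ?_ ?_
      · intro r hr
        exact (Gf_inv hs.ne' hr.1.le hr.2.le).symm
      · exact (Gf_inv hs.ne' zero_le_one le_rfl).symm
    have h7 := hud.eq_deriv _ h6 (hasDerivWithinAt_id 1 _)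
    simp at h7
  · exact h
  · exfalso
    apply hne
    have h1 : HasDerivAt (fun r : ℝ => (Gf s r : ℂ) • e) 0 1 := by
      have := ((Gf_deriv h).ofReal_comp).smul_const e
      simpa using this
    have hd : HasFDerivAt (𝕜 := ℝ) (phi a) ((fderiv ℂ (phi a) e).restrictScalars ℝ) e :=
      (phi_diff ha he.le).hasFDerivAt.restrictScalars ℝ
    have hd' : HasFDerivAt (𝕜 := ℝ) (phi a) ((fderiv ℂ (phi a) e).restrictScalars ℝ)
        ((fun r : ℝ => (Gf s r : ℂ) • e) 1) := by simpa [Gf_one hs.ne'] using hd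
    have h2 := (hd'.comp_hasDerivAt (1 : ℝ) h1).hasDerivWithinAt (s := Ioo 0 1)
    rw [map_zero] at h2
    have h3 : HasDerivWithinAt (fun r : ℝ => f (r * q)) 0 (Ioo 0 1) 1 := by
      refine h2.congr ?_ ?_
      · intro r hr
        simp only [Function.comp_apply]
        rw [← hray r hr.1 hr.2, phi_phi ha (hlt _ (hmem r hr)).le]
      · simp [hback, Gf_one hs.ne']
    exact hud.eq_deriv _ hc h3

lemma Gf_s_one {x : ℝ} (hx : 0 ≤ x) : Gf 1 x = x := by
  unfold Gf
  have : 1 + x ≠ 0 := by positivity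
  rw [Real.rpow_one]
  field_simp
  ring

lemma classify {m : ℕ} {h : ℂ → EuclideanSpace ℂ (Fin m)}
    (h0 : h 0 = 0)
    (hlt : ∀ z, ‖z‖ < 1 → ‖h z‖ < 1)
    (hn : ∀ z, ‖z‖ < 1 → ‖h z‖ = Gf 1 ‖z‖)
    (hQ : ∀ z w, ‖z‖ < 1 → ‖w‖ < 1 → Qf (h z) (h w) = 1 - Gf 1 (tauf z w) ^ 2) :
    ∃ e : EuclideanSpace ℂ (Fin m), ‖e‖ = 1 ∧ ((∀ z, ‖z‖ < 1 → h z = z • e) ∨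
      (∀ z, ‖z‖ < 1 → h z = (starRingEnd ℂ) z • e)) := by
  have hn' : ∀ z, ‖z‖ < 1 → ‖h z‖ = ‖z‖ := fun z hz => by rw [hn z hz, Gf_s_one (norm_nonneg z)]
  have hin : ∀ z w, ‖z‖ < 1 → ‖w‖ < 1 →
      ‖1 - (inner ℂ (h w) (h z) : ℂ)‖ ^ 2 = ‖1 - (starRingEnd ℂ) w * z‖ ^ 2 := by
    intro z w hz hw
    have h1 := hQ z w hz hw
    rw [Gf_s_one (tauf_nonneg z w), tauf_sq hz hw] at h1
    unfold Qf at h1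
    rw [hn' z hz, hn' w hw] at h1
    have p1 := norm_pos_iff.2 (disc_den_ne hz hw)
    have p2 : 0 < ‖1 - (inner ℂ (h w) (h z) : ℂ)‖ :=
      norm_pos_iff.2 (one_sub_inner_ne (hlt w hw) (hlt z hz).le)
    have h2 : 0 < 1 - ‖z‖ ^ 2 := by nlinarith [norm_nonneg z]
    have h3 : 0 < 1 - ‖w‖ ^ 2 := by nlinarith [norm_nonneg w]
    rw [div_eq_div_iff (by positivity) (by positivity)] at h1
    exact (mul_left_cancel₀ (mul_pos h2 h3).ne' h1).symm
  obtain ⟨e, he, hr⟩ := ray_exists one_pos hlt hn hQ (q := 1) norm_one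
  have hr' : ∀ r : ℝ, 0 < r → r < 1 → h r = (r : ℂ) • e := by
    intro r h0 h1
    have := hr r h0 h1
    rwa [mul_one, Gf_s_one h0.le] at this
  have hc : ∀ z, ‖z‖ < 1 → (inner ℂ e (h z) : ℂ).re = z.re ∧
      ‖(inner ℂ e (h z) : ℂ)‖ ^ 2 = ‖z‖ ^ 2 := by
    intro z hz
    have key : ∀ r : ℝ, 0 < r → r < 1 →
        -2 * r * (inner ℂ e (h z) : ℂ).re + r ^ 2 * ‖(inner ℂ e (h z) : ℂ)‖ ^ 2
        = -2 * r * z.re + r ^ 2 * ‖z‖ ^ 2 := by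
      intro r h0 h1
      have h2 := hin z r hz (by rw [Complex.norm_real, Real.norm_of_nonneg h0.le]; exact h1)
      rw [hr' r h0 h1, inner_smul_left] at h2
      simp only [Complex.sq_norm, Complex.normSq_apply, Complex.conj_ofReal] at h2 ⊢
      simp at h2
      linarith
    have k1 := key (1 / 2) (by norm_num) (by norm_num)
    have k2 := key (1 / 4) (by norm_num) (by norm_num)
    constructor <;> linarith
  have hpar : ∀ z, ‖z‖ < 1 → h z = (inner ℂ e (h z) : ℂ) • e := by
    intro z hz
    have h1 : ‖h z - (inner ℂ e (h z) : ℂ) • e‖ ^ 2 = 0 := by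
      have h2 := norm_sub_sq (𝕜 := ℂ) (h z) ((inner ℂ e (h z) : ℂ) • e)
      have h3 : inner ℂ (h z) ((inner ℂ e (h z) : ℂ) • e)
          = ((‖(inner ℂ e (h z) : ℂ)‖ ^ 2 : ℝ) : ℂ) := by
        rw [inner_smul_right, ← inner_conj_symm (h z) e, Complex.mul_conj,
          Complex.normSq_eq_norm_sq]
      rw [h3, norm_smul, he, hn' z hz, (hc z hz).2, mul_one, (hc z hz).2] at h2
      rw [h2, RCLike.re_eq_complex_re, Complex.ofReal_re]
      ring
    exact sub_eq_zero.1 (norm_eq_zero.1 (pow_eq_zero_iff two_ne_zero |>.1 h1))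
  have him : ∀ z, ‖z‖ < 1 → (inner ℂ e (h z) : ℂ).im ^ 2 = z.im ^ 2 := by
    intro z hz
    obtain ⟨h1, h2⟩ := hc z hz
    simp only [Complex.sq_norm, Complex.normSq_apply] at h2
    rw [h1] at h2
    linarith
  have hI : ‖(Complex.I / 2 : ℂ)‖ < 1 := by simp; norm_num
  have hI2 : (inner ℂ e (h (Complex.I / 2)) : ℂ).re = 0 := by
    rw [(hc _ hI).1]; simp
  have hI3 := him _ hI
  have hII : (Complex.I / 2 : ℂ).im = 1 / 2 := by simp
  rw [hII] at hI3
  -- imaginary parts are linked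
  have hlink : ∀ z, ‖z‖ < 1 →
      (inner ℂ e (h z) : ℂ).im * (inner ℂ e (h (Complex.I / 2)) : ℂ).im = z.im / 2 := by
    intro z hz
    have h1 := hin z _ hz hI
    have h2 := (hc z hz)
    have h3 := him z hz
    rw [hpar z hz, hpar _ hI] at h1
    rw [inner_smul_left, inner_smul_right, inner_self_eq_norm_sq_to_K, he] at h1
    have h4 : (starRingEnd ℂ) (Complex.I / 2) = -(Complex.I / 2) := by
      apply Complex.ext
      · simp [Complex.div_re]
      · simp [Complex.div_im]; norm_num
    rw [h4] at h1
    have h5 := h2.1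
    clear hpar him h2
    generalize (inner ℂ e (h (Complex.I / 2)) : ℂ) = c at *
    generalize (inner ℂ e (h z) : ℂ) = d at *
    simp only [Complex.sq_norm, Complex.normSq_apply] at h1
    simp [hI2, h5] at h1
    have h6 : c.im ^ 2 * d.im ^ 2 = z.im ^ 2 / 4 := by rw [hI3, h3]; ring
    have h7 : c.im ^ 2 * z.re ^ 2 = z.re ^ 2 / 4 := by rw [hI3]; ring
    ring_nf at h1 h6 h7 ⊢
    linarith
  refine ⟨e, he, ?_⟩
  have h5 : (inner ℂ e (h (Complex.I / 2)) : ℂ).im = 1 / 2 ∨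
      (inner ℂ e (h (Complex.I / 2)) : ℂ).im = - (1 / 2) := sq_eq_sq_iff_eq_or_eq_neg.1 hI3
  rcases h5 with h5 | h5
  · left
    intro z hz
    have h6 := hlink z hz
    rw [h5] at h6
    have h7 : (inner ℂ e (h z) : ℂ) = z := by
      apply Complex.ext
      · exact (hc z hz).1
      · linarith
    rw [hpar z hz, h7]
  · right
    intro z hz
    have h6 := hlink z hz
    rw [h5] at h6
    have h7 : (inner ℂ e (h z) : ℂ) = (starRingEnd ℂ) z := by
      apply Complex.ext
      · simpa using (hc z hz).1
      · simp; linarith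
    rw [hpar z hz, h7]

lemma exists_unitary {m : ℕ} (hm : 0 < m) (e : EuclideanSpace ℂ (Fin m)) (he : ‖e‖ = 1) :
    ∃ W : EuclideanSpace ℂ (Fin m) ≃ₗᵢ[ℂ] EuclideanSpace ℂ (Fin m),
      ∀ c : ℂ, W (c • e) = inclDisc m c := by
  obtain ⟨b, hb⟩ := Orthonormal.exists_orthonormalBasis_extension_of_card_eq (𝕜 := ℂ)
    (E := EuclideanSpace ℂ (Fin m)) (ι := Fin m) (by simp) (v := fun _ => e)
    (s := {(⟨0, hm⟩ : Fin m)}) (by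
      constructor
      · intro i; exact he
      · intro i j hij
        exact absurd (Subsingleton.elim i j) hij)
  refine ⟨b.repr, fun c => ?_⟩
  have h1 : b ⟨0, hm⟩ = e := hb _ rfl
  rw [map_smul, ← h1, b.repr_self]
  ext j
  simp [inclDisc, Fin.ext_iff]

/-- **Theorem 1.1** (target the unit ball). A `C²`-smooth totally geodesic isometric embedding
`f : (Δ, λ g_Δ) → (B^m, g_{B^m})` which extends `C¹` over an open boundary arc with nowhere
vanishing radial derivative satisfies `λ = 1` and is, up to an automorphism of `B^m`, the
standard embedding `ζ ↦ (ζ,0,…,0)` or its conjugate. -/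
theorem totally_geodesic_disc_in_ball
    (m : ℕ) (hm : 0 < m) (lam : ℝ) (hlam : 0 < lam)
    (f : ℂ → EuclideanSpace ℂ (Fin m))
    (hmap : ∀ z ∈ unitDisc, f z ∈ Metric.ball (0 : EuclideanSpace ℂ (Fin m)) 1)
    (hC2 : ContDiffOn ℝ 2 f unitDisc)
    (hiso : ∀ z ∈ unitDisc, ∀ w ∈ unitDisc,
      ballDist (f z) (f w) = Real.sqrt lam * pdist z w)
    (U : Set ℂ) (hU : U ⊆ unitCircle) (hUne : U.Nonempty)
    (hUopen : ∃ V : Set ℂ, IsOpen V ∧ U = V ∩ unitCircle)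
    (hC1 : ContDiffOn ℝ 1 f (unitDisc ∪ U))
    (hrad : ∀ q ∈ U, fderivWithin ℝ f (unitDisc ∪ U) q q ≠ 0) :
    lam = 1 ∧
    ∃ Ψ : EuclideanSpace ℂ (Fin m) → EuclideanSpace ℂ (Fin m), IsBiholoAutBall m Ψ ∧
      ((∀ ζ ∈ unitDisc, Ψ (f ζ) = inclDisc m ζ) ∨
       (∀ ζ ∈ unitDisc, Ψ (f ζ) = inclDisc m ((starRingEnd ℂ) ζ))) := by
  set s := Real.sqrt lam with hs
  have hspos : 0 < s := Real.sqrt_pos.2 hlam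
  have hflt : ∀ z ∈ unitDisc, ‖f z‖ < 1 := fun z hz => by simpa using hmap z hz
  have ha : ‖f 0‖ < 1 := hflt 0 (by simp [unitDisc])
  have hlt : ∀ z, ‖z‖ < 1 → ‖phi (f 0) (f z)‖ < 1 := fun z hz => phi_maps ha (hflt z hz)
  have hQ : ∀ z w, ‖z‖ < 1 → ‖w‖ < 1 →
      Qf (phi (f 0) (f z)) (phi (f 0) (f w)) = 1 - Gf s (tauf z w) ^ 2 := by
    intro z w hz hw
    rw [Qf_phi ha (hflt z hz) (hflt w hw)]
    exact Q_of_iso (hflt z hz) (hflt w hw) hz hw (hiso z hz w hw)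
  have h0 : phi (f 0) (f 0) = 0 := phi_self ha
  have hn : ∀ z, ‖z‖ < 1 → ‖phi (f 0) (f z)‖ = Gf s ‖z‖ := by
    intro z hz
    have := hQ z 0 hz (by simp)
    rw [h0] at this
    exact norm_h hspos hz this
  have hs1 : s = 1 := by
    obtain ⟨q, hq⟩ := hUne
    have hqn : ‖q‖ = 1 := hU hq
    obtain ⟨e, he, hray⟩ := ray_exists (h := fun z => phi (f 0) (f z)) hspos hlt hn hQ hqn
    have hd : DifferentiableWithinAt ℝ f (unitDisc ∪ U) q :=
      (hC1 q (Or.inr hq)).differentiableWithinAt one_ne_zero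
    exact radial hspos ha subset_union_left hqn hd.hasFDerivWithinAt (hrad q hq) hflt he hray
  refine ⟨?_, ?_⟩
  · have := Real.sq_sqrt hlam.le
    rw [← hs, hs1] at this
    linarith
  rw [hs1] at hQ hn
  obtain ⟨e, he, hcl⟩ := classify (h := fun z => phi (f 0) (f z)) h0 hlt hn hQ
  obtain ⟨W, hW⟩ := exists_unitary hm e he
  refine ⟨fun z => W (phi (f 0) z), ⟨?_, ?_, fun z => phi (f 0) (W.symm z), ?_, ?_, ?_, ?_⟩, ?_⟩
  · intro z hz
    have := phi_maps ha (z := z) (by simpa using hz)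
    simpa using this
  · intro z hz
    have hz' : ‖z‖ ≤ 1 := le_of_lt (by simpa using hz)
    exact (W.toContinuousLinearEquiv.differentiableAt.comp z
      (phi_diff ha hz')).differentiableWithinAt
  · intro z hz
    have := phi_maps ha (z := W.symm z) (by simpa using hz)
    simpa using this
  · intro z hz
    have hz' : ‖W.symm z‖ ≤ 1 := le_of_lt (by simpa using hz)
    exact (DifferentiableAt.comp z (phi_diff ha hz')
      W.symm.toContinuousLinearEquiv.differentiableAt).differentiableWithinAt
  · intro z hz
    simp only [LinearIsometryEquiv.symm_apply_apply]
    exact phi_phi ha (le_of_lt (by simpa using hz))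
  · intro z hz
    simp only []
    rw [phi_phi ha (le_of_lt (by simpa using hz))]
    simp
  · rcases hcl with h | h
    · left
      intro ζ hζ
      have := h ζ hζ
      simp only at this ⊢
      rw [this, hW]
    · right
      intro ζ hζ
      have := h ζ hζ
      simp only at this ⊢
      rw [this, hW]
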